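/- Suppose for each m the vector ℚ_m consists of an orthonormal basis of 𝒱_m²(w,ℂ) satisfying ℚ_m = J_{m+1} conj(ℚ_m), and z ℚ_n = α_n ℚ_{n+1} + β_n ℚ_n + (α_{n−1}*)^∨ ℚ_{n−1}. Then the Christoffel–Darboux formula holds: for all z ≠ ζ in ℂ, Σ_{m=0}^{n} ℚ_m(z,z̄)ᵀ conj(ℚ_m(ζ,ζ̄)) = [ ℚ_{n+1}(z,z̄)ᵀ α_nᵀ J_{n+1} ℚ_n(ζ,ζ̄) − ℚ_{n+1}(ζ,ζ̄)ᵀ α_nᵀ J_{n+1} ℚ_n(z,z̄) ] / (z − ζ). -/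

import Mathlib

open MeasureTheory MvPolynomial Matrix Complex
open scoped ComplexOrder

noncomputable section

/-- Evaluation of a polynomial in the two commuting variables `(z, z̄)` at a point `z ∈ ℂ`. -/
def evalz (p : MvPolynomial (Fin 2) ℂ) (z : ℂ) : ℂ :=
  MvPolynomial.eval (fun i : Fin 2 => if i = 0 then z else (starRingEnd ℂ) z) p

/-- The complex inner product `⟨f,g⟩ = ∫_Ω f conj(g) w`. -/
def cip (Ω : Set ℂ) (w : ℂ → ℝ) (p q : MvPolynomial (Fin 2) ℂ) : ℂ :=
  ∫ z in Ω, evalz p z * (starRingEnd ℂ) (evalz q z) * (w z : ℂ)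
/-- Conjugation of a polynomial in `(z, z̄)`: conjugate the coefficients and swap `z` and `z̄`. -/
def pconj (p : MvPolynomial (Fin 2) ℂ) : MvPolynomial (Fin 2) ℂ :=
  MvPolynomial.rename (Equiv.swap (0 : Fin 2) 1) (MvPolynomial.map (starRingEnd ℂ) p)
/-- Membership in `𝒱_n²(w,ℂ)`: total degree at most `n` and orthogonality to all
polynomials of total degree at most `n-1`. -/
def memV (Ω : Set ℂ) (w : ℂ → ℝ) (n : ℕ) (p : MvPolynomial (Fin 2) ℂ) : Prop :=
  p.totalDegree ≤ n ∧ ∀ q : MvPolynomial (Fin 2) ℂ, q.totalDegree < n → cip Ω w p q = 0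

/-- The `m × m` backward identity matrix. -/
def Jmat (m : ℕ) : Matrix (Fin m) (Fin m) ℂ :=
  fun r s => if r.1 + s.1 = m - 1 then 1 else 0

/-- `M^∨ = J_a conj(M) J_b` for an `a × b` complex matrix `M`. -/
def vee {a b : ℕ} (M : Matrix (Fin a) (Fin b) ℂ) : Matrix (Fin a) (Fin b) ℂ :=
  Jmat a * M.map (starRingEnd ℂ) * Jmat b

lemma evalz_add (p q : MvPolynomial (Fin 2) ℂ) (z : ℂ) :
    evalz (p + q) z = evalz p z + evalz q z := by
  simp [evalz]

lemma evalz_smul (c : ℂ) (p : MvPolynomial (Fin 2) ℂ) (z : ℂ) :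
    evalz (c • p) z = c * evalz p z := by
  simp [evalz, smul_eval]

lemma evalz_sum {ι : Type*} (s : Finset ι) (p : ι → MvPolynomial (Fin 2) ℂ) (z : ℂ) :
    evalz (∑ i ∈ s, p i) z = ∑ i ∈ s, evalz (p i) z := by
  simp [evalz]

lemma evalz_X_zero_mul (p : MvPolynomial (Fin 2) ℂ) (z : ℂ) :
    evalz (X 0 * p) z = z * evalz p z := by
  simp [evalz]

lemma evalz_pconj (p : MvPolynomial (Fin 2) ℂ) (z : ℂ) :
    evalz (pconj p) z = (starRingEnd ℂ) (evalz p z) := by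
  unfold evalz pconj
  rw [eval_rename, eval_map, ← eval₂_id, hom_eval₂]
  congr 1
  ext i
  fin_cases i <;> simp

lemma Jmat_apply (m : ℕ) (r s : Fin m) : Jmat m r s = if s = r.rev then 1 else 0 := by
  unfold Jmat
  refine if_congr ?_ rfl rfl
  rw [Fin.ext_iff, Fin.val_rev]
  omega

lemma Jmat_apply' (m : ℕ) (r s : Fin m) : Jmat m r s = if r = s.rev then 1 else 0 := by
  rw [Jmat_apply]
  exact if_congr (by rw [eq_comm, Fin.rev_eq_iff]) rfl rfl

lemma mul_Jmat_apply {a b : ℕ} (M : Matrix (Fin a) (Fin b) ℂ) (i : Fin a) (j : Fin b) :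
    (M * Jmat b) i j = M i j.rev := by
  simp [Matrix.mul_apply, Jmat_apply']

lemma Jmat_mul_apply {a b : ℕ} (M : Matrix (Fin a) (Fin b) ℂ) (i : Fin a) (j : Fin b) :
    (Jmat a * M) i j = M i.rev j := by
  simp [Matrix.mul_apply, Jmat_apply]

lemma vee_conjTranspose_apply {a b : ℕ} (M : Matrix (Fin a) (Fin b) ℂ) (i : Fin b) (j : Fin a) :
    vee Mᴴ i j = M j.rev i.rev := by
  simp [vee, mul_Jmat_apply, Jmat_mul_apply]

lemma cip_conj_symm (Ω : Set ℂ) (w : ℂ → ℝ) (p q : MvPolynomial (Fin 2) ℂ) :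
    cip Ω w p q = (starRingEnd ℂ) (cip Ω w q p) := by
  unfold cip
  rw [← integral_conj]
  refine integral_congr_ae (Filter.Eventually.of_forall fun z => ?_)
  simp [mul_comm]

lemma cip_add_left {Ω : Set ℂ} {w : ℂ → ℝ}
    (hInt : ∀ p q : MvPolynomial (Fin 2) ℂ,
      IntegrableOn (fun z => evalz p z * (starRingEnd ℂ) (evalz q z) * (w z : ℂ)) Ω)
    (p q r : MvPolynomial (Fin 2) ℂ) :
    cip Ω w (p + q) r = cip Ω w p r + cip Ω w q r := by
  unfold cip
  rw [← integral_add (hInt p r) (hInt q r)]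
  simp only [evalz_add, add_mul]

lemma cip_sum_smul_left {Ω : Set ℂ} {w : ℂ → ℝ}
    (hInt : ∀ p q : MvPolynomial (Fin 2) ℂ,
      IntegrableOn (fun z => evalz p z * (starRingEnd ℂ) (evalz q z) * (w z : ℂ)) Ω)
    {ι : Type*} (s : Finset ι) (c : ι → ℂ)
    (p : ι → MvPolynomial (Fin 2) ℂ) (r : MvPolynomial (Fin 2) ℂ) :
    cip Ω w (∑ i ∈ s, c i • p i) r = ∑ i ∈ s, c i * cip Ω w (p i) r := by
  unfold cip
  simp_rw [← integral_const_mul]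
  rw [← integral_finsetSum _ fun i _ => (hInt (p i) r).const_mul (c i)]
  simp only [evalz_sum, evalz_smul, Finset.sum_mul, mul_assoc]

/-- In a three-term relation the middle coefficient matrix satisfies `(β J)ᵀ = β J`. -/
lemma middle_coeff_symm {Ω : Set ℂ} {w : ℂ → ℝ}
    (hInt : ∀ p q : MvPolynomial (Fin 2) ℂ,
      IntegrableOn (fun z => evalz p z * (starRingEnd ℂ) (evalz q z) * (w z : ℂ)) Ω)
    {n : ℕ} {Q : Fin (n+1) → MvPolynomial (Fin 2) ℂ}
    (hon : ∀ k j, cip Ω w (Q k) (Q j) = if k = j then 1 else 0)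
    (hsymm : ∀ k, Q k = pconj (Q k.rev))
    (β : Matrix (Fin (n+1)) (Fin (n+1)) ℂ) (R : Fin (n+1) → MvPolynomial (Fin 2) ℂ)
    (hR : ∀ k j, cip Ω w (R k) (Q j) = 0)
    (hrel : ∀ k, X 0 * Q k = ∑ j, β k j • Q j + R k) (k j : Fin (n+1)) :
    β k j.rev = β j k.rev := by
  have entry : ∀ k j, β k j = cip Ω w (X 0 * Q k) (Q j) := fun k j => by
    rw [hrel, cip_add_left hInt, cip_sum_smul_left hInt, hR]
    simp [hon]
  have conj_rev : ∀ k z, (starRingEnd ℂ) (evalz (Q k.rev) z) = evalz (Q k) z := fun k z => by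
    rw [← evalz_pconj, ← hsymm]
  rw [entry, entry]
  unfold cip
  simp only [evalz_X_zero_mul, conj_rev]
  congr 1
  ext z
  ring

/-- The bilinear form `u(z)ᵀ αᵀ J v` in coordinates. -/
lemma dotProduct_transpose_mul_Jmat_mulVec {a b : ℕ} (M : Matrix (Fin a) (Fin b) ℂ)
    (u : Fin b → ℂ) (v : Fin a → ℂ) :
    u ⬝ᵥ ((Mᵀ * Jmat a) *ᵥ v) = ∑ k, (∑ j, M k j * u j) * v k.rev := by
  simp only [dotProduct, mulVec, mul_Jmat_apply, transpose_apply, Finset.mul_sum, Finset.sum_mul]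
  rw [Finset.sum_comm, ← Equiv.sum_comp Fin.revPerm]
  simp only [Fin.revPerm_apply, Fin.rev_rev]
  exact Finset.sum_congr rfl fun _ _ => Finset.sum_congr rfl fun _ _ => by ring

lemma sum_mul_rev_comm {m : ℕ} (f g : Fin m → ℂ) :
    ∑ k, f k * g k.rev = ∑ k, g k * f k.rev := by
  rw [← Equiv.sum_comp Fin.revPerm]
  simp [mul_comm]

lemma sum_mul_rev_symm {m : ℕ} {β : Matrix (Fin m) (Fin m) ℂ}
    (hβ : ∀ k j, β k j.rev = β j k.rev) (u v : Fin m → ℂ) :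
    ∑ k, (∑ j, β k j * u j) * v k.rev = ∑ k, (∑ j, β k j * v j) * u k.rev := by
  simp only [Finset.sum_mul]
  rw [Finset.sum_comm, ← Equiv.sum_comp Fin.revPerm]
  refine Finset.sum_congr rfl fun j _ => ?_
  rw [← Equiv.sum_comp Fin.revPerm]
  refine Finset.sum_congr rfl fun k _ => ?_
  have h := hβ k.rev j
  rw [Fin.rev_rev] at h
  simp only [Fin.revPerm_apply, Fin.rev_rev, h]
  ring

lemma sum_vee_mul_rev {a b : ℕ} (M : Matrix (Fin a) (Fin b) ℂ) (u : Fin a → ℂ) (v : Fin b → ℂ) :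
    ∑ k, (∑ j, vee Mᴴ k j * u j) * v k.rev = v ⬝ᵥ ((Mᵀ * Jmat a) *ᵥ u) := by
  rw [← Equiv.sum_comp Fin.revPerm]
  simp only [dotProduct, mulVec, vee_conjTranspose_apply, mul_Jmat_apply, transpose_apply,
    Fin.revPerm_apply, Fin.rev_rev]
  exact Finset.sum_congr rfl fun _ _ => mul_comm _ _

/-- **Christoffel–Darboux formula.** For orthonormal bases `ℚ_m` of
`𝒱_m²(w,ℂ)` satisfying `ℚ_m = J_{m+1} conj(ℚ_m)` and the three-term relation
`z ℚ_n = α_n ℚ_{n+1} + β_n ℚ_n + (α_{n-1}*)^∨ ℚ_{n-1}`, for all `z ≠ ζ`: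
`∑_{m≤n} ℚ_m(z)ᵀ conj(ℚ_m(ζ)) = [ℚ_{n+1}(z)ᵀ α_nᵀ J_{n+1} ℚ_n(ζ) − ℚ_{n+1}(ζ)ᵀ α_nᵀ J_{n+1} ℚ_n(z)]/(z−ζ)`. -/
theorem stmt_13 (Ω : Set ℂ) (w : ℂ → ℝ)
    (hw : ∀ z ∈ Ω, 0 ≤ w z)
    (hnorm : (∫ z in Ω, w z) = 1)
    (hInt : ∀ p q : MvPolynomial (Fin 2) ℂ,
      IntegrableOn (fun z => evalz p z * (starRingEnd ℂ) (evalz q z) * (w z : ℂ)) Ω)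
    (hpos : ∀ p : MvPolynomial (Fin 2) ℂ, p ≠ 0 → 0 < cip Ω w p p)
    (Q : (m : ℕ) → Fin (m+1) → MvPolynomial (Fin 2) ℂ)
    (hmem : ∀ m k, memV Ω w m (Q m k))
    (hon : ∀ m (k j : Fin (m+1)), cip Ω w (Q m k) (Q m j) = if k = j then 1 else 0)
    (hsymm : ∀ m (k : Fin (m+1)), Q m k = pconj (Q m k.rev))
    (α : (n : ℕ) → Matrix (Fin (n+1)) (Fin (n+2)) ℂ)
    (β : (n : ℕ) → Matrix (Fin (n+1)) (Fin (n+1)) ℂ)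
    (hrel0 : ∀ k, X 0 * Q 0 k = ∑ j, α 0 k j • Q 1 j + ∑ j, β 0 k j • Q 0 j)
    (hrel : ∀ n (k : Fin (n+2)), X 0 * Q (n+1) k =
      ∑ j, α (n+1) k j • Q (n+2) j + ∑ j, β (n+1) k j • Q (n+1) j
        + ∑ j, vee ((α n)ᴴ) k j • Q n j)
    (n : ℕ) (z ζ : ℂ) (hzζ : z ≠ ζ) :
    ∑ m ∈ Finset.range (n+1), ∑ k : Fin (m+1),
        evalz (Q m k) z * (starRingEnd ℂ) (evalz (Q m k) ζ)
      = ((fun j => evalz (Q (n+1) j) z) ⬝ᵥ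
            (((α n)ᵀ * Jmat (n+1)) *ᵥ (fun k => evalz (Q n k) ζ))
          - (fun j => evalz (Q (n+1) j) ζ) ⬝ᵥ
            (((α n)ᵀ * Jmat (n+1)) *ᵥ (fun k => evalz (Q n k) z))) / (z - ζ) := by
  have conj_rev : ∀ m k z, (starRingEnd ℂ) (evalz (Q m k) z) = evalz (Q m k.rev) z :=
    fun m k z => by rw [← evalz_pconj, hsymm m k.rev, Fin.rev_rev]
  have orth : ∀ m l (k : Fin (m+1)) (j : Fin (l+1)), l < m → cip Ω w (Q m k) (Q l j) = 0 :=
    fun m l k j h => (hmem m k).2 _ ((hmem l j).1.trans_lt h)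
  have orth' : ∀ m l (k : Fin (m+1)) (j : Fin (l+1)), l < m → cip Ω w (Q l j) (Q m k) = 0 :=
    fun m l k j h => by rw [cip_conj_symm, orth m l k j h, map_zero]
  have hβ0 : ∀ k j, β 0 k j.rev = β 0 j k.rev :=
    middle_coeff_symm hInt (hon 0) (hsymm 0) (β 0) (fun k => ∑ j, α 0 k j • Q 1 j)
      (fun k j => by
        rw [cip_sum_smul_left hInt]
        exact Finset.sum_eq_zero fun i _ => by rw [orth _ _ _ _ zero_lt_one, mul_zero])
      (fun k => by rw [hrel0, add_comm])
  have hβ : ∀ n k j, β (n+1) k j.rev = β (n+1) j k.rev := fun n =>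
    middle_coeff_symm hInt (hon (n+1)) (hsymm (n+1)) (β (n+1))
      (fun k => ∑ j, α (n+1) k j • Q (n+2) j + ∑ j, vee ((α n)ᴴ) k j • Q n j)
      (fun k j => by
        rw [cip_add_left hInt, cip_sum_smul_left hInt, cip_sum_smul_left hInt,
          Finset.sum_eq_zero fun i _ => by rw [orth _ _ _ _ (Nat.lt_succ_self _), mul_zero],
          Finset.sum_eq_zero fun i _ => by rw [orth' _ _ _ _ (Nat.lt_succ_self _), mul_zero],
          add_zero])
      (fun k => by rw [hrel]; abel)
  rw [eq_div_iff (sub_ne_zero.mpr hzζ)]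
  simp only [conj_rev]
  have split : ∀ m, (∑ k : Fin (m+1), evalz (Q m k) z * evalz (Q m k.rev) ζ) * (z - ζ)
      = ∑ k, evalz (X 0 * Q m k) z * evalz (Q m k.rev) ζ
        - ∑ k, evalz (X 0 * Q m k) ζ * evalz (Q m k.rev) z := fun m => by
    simp only [evalz_X_zero_mul, mul_assoc]
    rw [← Finset.mul_sum, ← Finset.mul_sum,
      sum_mul_rev_comm (fun k => evalz (Q m k) ζ) (fun k => evalz (Q m k) z)]
    ring
  induction n with
  | zero =>
    rw [Finset.sum_range_one, split]
    simp only [hrel0, evalz_add, evalz_sum, evalz_smul, add_mul, Finset.sum_add_distrib]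
    rw [dotProduct_transpose_mul_Jmat_mulVec, dotProduct_transpose_mul_Jmat_mulVec,
      sum_mul_rev_symm hβ0 (fun k => evalz (Q 0 k) z) (fun k => evalz (Q 0 k) ζ)]
    ring
  | succ n ih =>
    rw [Finset.sum_range_succ, add_mul, ih, split]
    simp only [hrel, evalz_add, evalz_sum, evalz_smul, add_mul, Finset.sum_add_distrib]
    rw [sum_vee_mul_rev (α n) (fun k => evalz (Q n k) z) (fun k => evalz (Q (n+1) k) ζ),
      sum_vee_mul_rev (α n) (fun k => evalz (Q n k) ζ) (fun k => evalz (Q (n+1) k) z),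
      dotProduct_transpose_mul_Jmat_mulVec (α (n+1)),
      dotProduct_transpose_mul_Jmat_mulVec (α (n+1)),
      sum_mul_rev_symm (hβ n) (fun k => evalz (Q (n+1) k) z) (fun k => evalz (Q (n+1) k) ζ)]
    ring
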